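/- arXiv:1706.08684 — 7 statements merged into one kernel-verified Lean document; each statement's English description precedes it below -/
import Mathlib

section
/- For all integers s, c, u ≥ 1 and all real numbers κ ∈ (0,1) and η ∈ (0,1), there exists a C^∞ diffeomorphism h of ℝ^s × ℝ^c × ℝ^u such that, writing R := [0,η]^s × [0,1]^c × [0,η]^u: (0) h equals the identity outside the interior of R (in particular h maps R onto R and is the identity on a neighborhood of the boundary of R); (1) h is κ-C¹-close to the identity, i.e. ‖h(x) − x‖ ≤ κ and ‖Dh(x) − Id‖ ≤ κ (operator norm) for every x; (2) h does not change the first coordinate, i.e. h(a, b, w) = (a, h₂(a,b,w), h₃(a,b,w)) for all (a,b,w) ∈ ℝ^s × ℝ^c × ℝ^u; (3) for every (a, b) ∈ [η/4, 3η/4]^s × [1/4, 3/4]^c, the image under h of the disk {a} × {b} × [0,η]^u contains two points p and q whose ℝ^c-components differ in norm by more than κη/10 and whose ℝ^u-components both lie in [η/4, 3η/4]^u. -/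
open Set

open MeasureTheory Metric in
/-- Mollification of a Lipschitz function keeps its Lipschitz constant. -/
theorem LipschitzWith.exists_contDiff_lipschitzWith_dist_le {E : Type*} [NormedAddCommGroup E]
    [NormedSpace ℝ E] [FiniteDimensional ℝ E] {K : NNReal} {f : E → ℝ} (hf : LipschitzWith K f)
    {ε : ℝ} (hε : 0 < ε) :
    ∃ g : E → ℝ, ContDiff ℝ (⊤ : ℕ∞) g ∧ LipschitzWith K g ∧
      ∀ a, ∀ δ, (∀ x ∈ ball a ε, dist (f x) (f a) ≤ δ) → dist (g a) (f a) ≤ δ := by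
  borelize E
  let μ : Measure E := Measure.addHaar
  let φ : ContDiffBump (0 : E) := ⟨ε / 2, ε, by positivity, by linarith⟩
  have hexists : ConvolutionExists (φ.normed μ) f (ContinuousLinearMap.lsmul ℝ ℝ) μ :=
    φ.hasCompactSupport_normed.convolutionExists_left _ φ.continuous_normed
      hf.continuous.locallyIntegrable
  refine ⟨convolution (φ.normed μ) f (ContinuousLinearMap.lsmul ℝ ℝ) μ,
    φ.hasCompactSupport_normed.contDiff_convolution_left _ φ.contDiff_normed
      hf.continuous.locallyIntegrable, ?_,
    fun a δ ↦ φ.dist_normed_convolution_le hf.continuous.aestronglyMeasurable⟩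
  refine LipschitzWith.of_dist_le_mul fun x y ↦ ?_
  rw [dist_eq_norm, convolution_def, convolution_def, ← integral_sub (hexists x) (hexists y)]
  calc _ ≤ ∫ t, φ.normed μ t * (K * dist x y) ∂μ := by
        refine norm_integral_le_of_norm_le (φ.integrable_normed.mul_const _) (.of_forall fun t ↦ ?_)
        rw [← map_sub, ContinuousLinearMap.lsmul_apply, norm_smul,
          Real.norm_of_nonneg (φ.nonneg_normed t), ← dist_eq_norm]
        gcongr
        · exact φ.nonneg_normed t
        · simpa using hf.dist_le_mul (x - t) (y - t)
    _ = K * dist x y := by rw [integral_mul_const, φ.integral_normed, one_mul]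

/-- A smooth contractive perturbation of the identity is a diffeomorphism. -/
theorem LipschitzWith.exists_contDiff_inverse_id_add {E : Type*} [NormedAddCommGroup E]
    [NormedSpace ℝ E] [CompleteSpace E] {K : NNReal} (hK : K < 1) {f : E → E}
    {n : WithTop ℕ∞} (hn : n ≠ 0) (hf : LipschitzWith K f) (hsmooth : ContDiff ℝ n f) :
    ∃ g : E → E, ContDiff ℝ n g ∧ Function.LeftInverse g (fun x ↦ x + f x) ∧
      Function.RightInverse g (fun x ↦ x + f x) := by
  have happrox : ApproximatesLinearOn (fun x ↦ x + f x)
      (ContinuousLinearEquiv.refl ℝ E : E →L[ℝ] E) univ K := fun x _ y _ ↦ by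
    simpa [add_sub_add_comm] using hf.norm_sub_le x y
  have hc : Subsingleton E ∨
      K < ‖((ContinuousLinearEquiv.refl ℝ E).symm : E →L[ℝ] E)‖₊⁻¹ := by
    rcases subsingleton_or_nontrivial E with h | h
    · exact Or.inl h
    · refine Or.inr ?_
      have h1 : ‖((ContinuousLinearEquiv.refl ℝ E).symm : E →L[ℝ] E)‖₊ = 1 :=
        NNReal.eq ContinuousLinearMap.norm_id
      rwa [h1, inv_one]
  let e := ApproximatesLinearOn.toHomeomorph _ happrox hc
  have hlt (a : E) : ‖-fderiv ℝ f a‖ < 1 := by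
    rw [norm_neg]
    exact (norm_fderiv_le_of_lipschitz ℝ hf).trans_lt (by exact_mod_cast hK)
  refine ⟨e.symm, e.contDiff_symm
    (f₀' := fun a ↦ ContinuousLinearEquiv.unitsEquiv ℝ E (Units.oneSub _ (hlt a)))
    (fun a ↦ ?_) (contDiff_id.add hsmooth), e.left_inv, e.right_inv⟩
  refine ((hasFDerivAt_id a).add (hsmooth.differentiable hn a).hasFDerivAt).congr_fderiv ?_
  ext v
  simp [ContinuousLinearEquiv.unitsEquiv_apply]

/-- The product of the three coordinate spaces containing the cube. -/
abbrev CubeSpace (s c u : ℕ) : Type := (Fin s → ℝ) × (Fin c → ℝ) × (Fin u → ℝ)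

/-- **Elementary perturbation** (Lemma 5.1 of Crovisier–Potrie–Sambarino).
For integers `s, c, u ≥ 1` and reals `κ, η ∈ (0,1)`, there is a `C^∞` diffeomorphism `h` of
`ℝ^s × ℝ^c × ℝ^u` (with smooth inverse `hinv`), equal to the identity outside the interior of
`R = [0,η]^s × [0,1]^c × [0,η]^u`, which is `κ`-`C¹`-close to the identity, does not change the
first coordinate, and moves the vertical disks `{a} × {b} × [0,η]^u` (for `(a,b)` in the middle
part of the cube) so that their images contain two points whose center components differ in norm
by more than `κη/10` and whose `ℝ^u`-components lie in `[η/4, 3η/4]^u`. -/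
theorem stmt_0 (s c u : ℕ) (hs : 1 ≤ s) (hc : 1 ≤ c) (hu : 1 ≤ u)
    (κ η : ℝ) (hκ : κ ∈ Ioo (0:ℝ) 1) (hη : η ∈ Ioo (0:ℝ) 1) :
    ∃ h hinv : (Fin s → ℝ) × (Fin c → ℝ) × (Fin u → ℝ) →
        (Fin s → ℝ) × (Fin c → ℝ) × (Fin u → ℝ),
      ContDiff ℝ (⊤ : ℕ∞) h ∧ ContDiff ℝ (⊤ : ℕ∞) hinv ∧
      Function.LeftInverse hinv h ∧ Function.RightInverse hinv h ∧
      (∀ p, p ∉ interior {q : (Fin s → ℝ) × (Fin c → ℝ) × (Fin u → ℝ) |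
          (∀ i, q.1 i ∈ Icc (0:ℝ) η) ∧ (∀ i, q.2.1 i ∈ Icc (0:ℝ) 1) ∧
          (∀ i, q.2.2 i ∈ Icc (0:ℝ) η)} → h p = p) ∧
      (∀ p, ‖h p - p‖ ≤ κ) ∧
      (∀ p, ‖fderiv ℝ h p -
          ContinuousLinearMap.id ℝ ((Fin s → ℝ) × (Fin c → ℝ) × (Fin u → ℝ))‖ ≤ κ) ∧
      (∀ p, (h p).1 = p.1) ∧
      ∀ (a : Fin s → ℝ) (b : Fin c → ℝ),
        (∀ i, a i ∈ Icc (η/4) (3*η/4)) → (∀ i, b i ∈ Icc (1/4 : ℝ) (3/4)) →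
        ∃ wp wq : Fin u → ℝ,
          (∀ i, wp i ∈ Icc (0:ℝ) η) ∧ (∀ i, wq i ∈ Icc (0:ℝ) η) ∧
          κ * η / 10 < ‖(h (a, b, wp)).2.1 - (h (a, b, wq)).2.1‖ ∧
          (∀ i, (h (a, b, wp)).2.2 i ∈ Icc (η/4) (3*η/4)) ∧
          (∀ i, (h (a, b, wq)).2.2 i ∈ Icc (η/4) (3*η/4)) := by
  obtain ⟨hκ0, hκ1⟩ := hκ
  obtain ⟨hη0, hη1⟩ := hη
  have : Nonempty (Fin c) := ⟨⟨0, hc⟩⟩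
  have : Nonempty (Fin u) := ⟨⟨0, hu⟩⟩
  let core : Set (CubeSpace s c u) := {q | (∀ i, q.1 i ∈ Icc (η/4) (3*η/4)) ∧
    (∀ i, q.2.1 i ∈ Icc (1/4 : ℝ) (3/4)) ∧ q.2.2 = fun _ ↦ η/2}
  have hcore : core.Nonempty := ⟨(fun _ ↦ η/2, fun _ ↦ 1/2, fun _ ↦ η/2),
    fun _ ↦ ⟨by linarith, by linarith⟩, fun _ ↦ ⟨by norm_num, by norm_num⟩, rfl⟩
  let f : CubeSpace s c u → ℝ := fun p ↦ max (η/5 - Metric.infDist p core) 0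
  have hf : LipschitzWith 1 f := by
    have h1 : LipschitzWith (0 + 1) fun p : CubeSpace s c u ↦ η/5 - Metric.infDist p core :=
      (LipschitzWith.const (η/5)).sub (Metric.lipschitz_infDist_pt core)
    rw [zero_add] at h1
    exact h1.max_const 0
  obtain ⟨g, hg_smooth, hg_lip, hg⟩ :=
    hf.exists_contDiff_lipschitzWith_dist_le (ε := η/40) (by positivity)
  have hgf (p : CubeSpace s c u) : |g p - f p| ≤ η/40 := by
    rw [← Real.dist_eq]
    refine hg p _ fun x hx ↦ ?_
    have := hf.dist_le_mul x p
    rw [NNReal.coe_one, one_mul] at this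
    exact this.trans (Metric.mem_ball.1 hx).le
  have hg_zero (p : CubeSpace s c u) (hp : η/4 ≤ Metric.infDist p core) : g p = 0 := by
    have hf0 (x : CubeSpace s c u) (hx : dist x p ≤ η/40) : f x = 0 := by
      have := Metric.infDist_le_infDist_add_dist (s := core) (x := p) (y := x)
      rw [dist_comm] at this
      exact max_eq_right (by linarith)
    have hfp : f p = 0 := hf0 p (by rw [dist_self]; positivity)
    have := hg p 0 fun x hx ↦ by rw [hf0 x (Metric.mem_ball.1 hx).le, hfp, dist_self]
    rw [hfp] at this
    exact dist_le_zero.1 this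
  have hg_abs (p : CubeSpace s c u) : |g p| ≤ 1 := by
    have h1 : f p ≤ η/5 := max_le (by linarith [Metric.infDist_nonneg (x := p) (s := core)])
      (by positivity)
    have h2 : 0 ≤ f p := le_max_right _ _
    have := abs_le.1 (hgf p)
    exact abs_le.2 ⟨by linarith, by linarith⟩
  let v : CubeSpace s c u := (0, fun _ ↦ 1, 0)
  have hv : ‖v‖ = 1 := by simp [v, Prod.norm_def]
  let ψ : CubeSpace s c u → CubeSpace s c u := fun p ↦ (κ * g p) • v
  have hψ_smooth : ContDiff ℝ (⊤ : ℕ∞) ψ := (contDiff_const.mul hg_smooth).smul contDiff_const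
  have hψ_lip : LipschitzWith ⟨κ, hκ0.le⟩ ψ := LipschitzWith.of_dist_le_mul fun x y ↦ by
    have h1 := hg_lip.dist_le_mul x y
    rw [NNReal.coe_one, one_mul, Real.dist_eq] at h1
    rw [dist_eq_norm, ← sub_smul, norm_smul, hv, mul_one, ← mul_sub, Real.norm_eq_abs, abs_mul,
      abs_of_pos hκ0]
    exact mul_le_mul_of_nonneg_left h1 hκ0.le
  obtain ⟨hinv, hinv_smooth, hleft, hright⟩ := hψ_lip.exists_contDiff_inverse_id_add
    (by exact_mod_cast hκ1) (by simp) hψ_smooth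
  refine ⟨fun p ↦ p + ψ p, hinv, contDiff_id.add hψ_smooth, hinv_smooth, hleft, hright,
    fun p hp ↦ ?_, fun p ↦ ?_, fun p ↦ ?_, fun p ↦ ?_, fun a b ha hb ↦ ?_⟩
  · suffices η/4 ≤ Metric.infDist p core by simp [ψ, hg_zero p this]
    contrapose! hp
    refine interior_maximal (t := {q : CubeSpace s c u | Metric.infDist q core < η/4})
      (fun q hq ↦ ?_) (isOpen_lt (Metric.continuous_infDist_pt core) continuous_const) hp
    obtain ⟨y, ⟨hy1, hy2, hy3⟩, hqy⟩ := (Metric.infDist_lt_iff hcore).1 hq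
    rw [Prod.dist_eq, max_lt_iff, Prod.dist_eq, max_lt_iff] at hqy
    obtain ⟨hd1, hd2, hd3⟩ := hqy
    refine ⟨fun i ↦ ?_, fun i ↦ ?_, fun i ↦ ?_⟩
    · have := abs_lt.1 ((dist_le_pi_dist q.1 y.1 i).trans_lt hd1)
      have := hy1 i
      constructor <;> linarith [this.1, this.2]
    · have := abs_lt.1 ((dist_le_pi_dist q.2.1 y.2.1 i).trans_lt hd2)
      have := hy2 i
      constructor <;> linarith [this.1, this.2]
    · have := abs_lt.1 ((dist_le_pi_dist q.2.2 y.2.2 i).trans_lt hd3)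
      have := congrFun hy3 i
      constructor <;> linarith
  · rw [add_sub_cancel_left, norm_smul, hv, mul_one, Real.norm_eq_abs, abs_mul, abs_of_pos hκ0]
    exact mul_le_of_le_one_right hκ0.le (hg_abs p)
  · have hderiv : HasFDerivAt (fun p ↦ p + ψ p) (ContinuousLinearMap.id ℝ _ + fderiv ℝ ψ p) p :=
      (hasFDerivAt_id p).add (hψ_smooth.differentiable (by simp) p).hasFDerivAt
    rw [hderiv.fderiv, add_sub_cancel_left]
    exact norm_fderiv_le_of_lipschitz ℝ hψ_lip
  · simp [ψ, v]
  · refine ⟨fun _ ↦ η/2, fun _ ↦ η/4, fun _ ↦ ⟨by linarith, by linarith⟩,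
      fun _ ↦ ⟨by linarith, by linarith⟩, ?_, fun i ↦ ?_, fun i ↦ ?_⟩
    · have hp : 7 * η / 40 ≤ g (a, b, fun _ ↦ η/2) := by
        have hfp : f (a, b, fun _ ↦ η/2) = η/5 := by
          have h0 : Metric.infDist ((a, b, fun _ ↦ η/2) : CubeSpace s c u) core = 0 :=
            Metric.infDist_zero_of_mem ⟨ha, hb, rfl⟩
          simp only [f, h0, sub_zero]
          exact max_eq_left (by positivity)
        have := abs_le.1 (hgf (a, b, fun _ ↦ η/2))
        rw [hfp] at this
        linarith
      have hq : g (a, b, fun _ ↦ η/4) = 0 := by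
        refine hg_zero _ ((Metric.le_infDist hcore).2 fun y hy ↦ ?_)
        refine le_trans ?_ ((le_max_right _ _).trans (le_max_right _ _))
        rw [hy.2.2, dist_pi_const, Real.dist_eq, abs_sub_comm]
        exact le_trans (by linarith) (le_abs_self _)
      have hdiff : (((a, b, fun _ ↦ η/2) + ψ (a, b, fun _ ↦ η/2) : CubeSpace s c u)).2.1 -
          (((a, b, fun _ ↦ η/4) + ψ (a, b, fun _ ↦ η/4) : CubeSpace s c u)).2.1 =
          fun _ ↦ κ * g (a, b, fun _ ↦ η/2) := by
        ext i
        simp [ψ, v, hq]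
      refine lt_of_lt_of_eq ?_ (congrArg norm hdiff).symm
      rw [pi_norm_const, Real.norm_eq_abs]
      refine lt_of_lt_of_le ?_ (le_abs_self _)
      nlinarith [mul_pos hκ0 hη0]
    · simp only [ψ, v, Prod.snd_add, Prod.smul_snd, smul_zero, add_zero]
      exact ⟨by linarith, by linarith⟩
    · simp only [ψ, v, Prod.snd_add, Prod.smul_snd, smul_zero, add_zero]
      exact ⟨by linarith, by linarith⟩
end

section
/- Let s, c, u ≥ 1 be integers and let θ, η, κ > 0 satisfy η < 1 and θ < min{κ/10, 1/20}. Then there exists α > 0 (one may take α = (η/2)(κ/20 − θ/2)) with the following property. In ℝ^s × ℝ^c × ℝ^u, let ϑ₁ be the graph {((g₁(w))₁, (g₁(w))₂, w) : w ∈ [η/4, 3η/4]^u} of a θ-Lipschitz map g₁ : [η/4, 3η/4]^u → [0,1]^s × [0,1]^c, and let ϑ₂ and ϑ₃ be the graphs {(z, (gᵢ(z))₁, (gᵢ(z))₂) : z ∈ [0,1]^s} of α-Lipschitz maps gᵢ : [0,1]^s → [0,1]^c × [0,1]^u (i = 2, 3). If ϑ₂ and ϑ₃ both intersect ϑ₁,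 then any two points p, q ∈ ϑ₂ ∪ ϑ₃ satisfy ‖p₂ − q₂‖ ≤ κη/20, where p₂ denotes the ℝ^c-component of p. -/
open Set

/-- For `x, y` in the cube `[a, b]^ι`, the sup-norm distance is at most `b - a`. -/
theorem norm_sub_le_of_forall_mem_Icc {ι : Type*} [Fintype ι] {a b : ℝ} (hab : a ≤ b)
    {x y : ι → ℝ} (hx : ∀ i, x i ∈ Icc a b) (hy : ∀ i, y i ∈ Icc a b) : ‖x - y‖ ≤ b - a := by
  refine (pi_norm_le_iff_of_nonneg (by linarith)).2 fun i => ?_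
  rw [Pi.sub_apply, Real.norm_eq_abs, abs_le]
  constructor <;> linarith [(hx i).1, (hx i).2, (hy i).1, (hy i).2]

/-- The first components of an `α`-Lipschitz map on `[0, 1]^ι` are within `α` of each other. -/
theorem norm_fst_sub_le_of_lipschitz {ι E F : Type*} [Fintype ι] [SeminormedAddCommGroup E]
    [SeminormedAddCommGroup F] {g : (ι → ℝ) → E × F} {α : ℝ} (hα : 0 ≤ α)
    (hg : ∀ z z' : ι → ℝ, (∀ i, z i ∈ Icc (0 : ℝ) 1) → (∀ i, z' i ∈ Icc (0 : ℝ) 1) →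
      ‖g z - g z'‖ ≤ α * ‖z - z'‖)
    {z z' : ι → ℝ} (hz : ∀ i, z i ∈ Icc (0 : ℝ) 1) (hz' : ∀ i, z' i ∈ Icc (0 : ℝ) 1) :
    ‖(g z).1 - (g z').1‖ ≤ α := by
  have h : ‖z - z'‖ ≤ 1 := by
    simpa using norm_sub_le_of_forall_mem_Icc zero_le_one hz hz'
  calc ‖(g z).1 - (g z').1‖ ≤ ‖g z - g z'‖ := norm_fst_le (g z - g z')
    _ ≤ α * ‖z - z'‖ := hg z z' hz hz'
    _ ≤ α := mul_le_of_le_one_right hα h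

/-- **Proposition 5.5 (prop-variationLip)** of Crovisier–Potrie–Sambarino.
In `ℝ^s × ℝ^c × ℝ^u` (sup-norms), if `ϑ₁` is the graph over `[η/4, 3η/4]^u` of a `θ`-Lipschitz
map `g₁` into `[0,1]^s × [0,1]^c`, and `ϑ₂, ϑ₃` are graphs over `[0,1]^s` of `α`-Lipschitz maps
`g₂, g₃` into `[0,1]^c × [0,1]^u` both meeting `ϑ₁`, then (for a suitable `α > 0`) any two
points of `ϑ₂ ∪ ϑ₃` have center components at distance at most `κη/20`. -/
theorem stmt_1 (s c u : ℕ) (hs : 1 ≤ s) (hc : 1 ≤ c) (hu : 1 ≤ u)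
    (θ η κ : ℝ) (hθ : 0 < θ) (hη : 0 < η) (hη1 : η < 1) (hκ : 0 < κ)
    (hθκ : θ < min (κ/10) (1/20)) :
    ∃ α > (0:ℝ),
      ∀ (g₁ : (Fin u → ℝ) → (Fin s → ℝ) × (Fin c → ℝ))
        (g₂ g₃ : (Fin s → ℝ) → (Fin c → ℝ) × (Fin u → ℝ)),
      -- `g₁` is `θ`-Lipschitz on `[η/4, 3η/4]^u` with values in `[0,1]^s × [0,1]^c`
      (∀ w w' : Fin u → ℝ, (∀ i, w i ∈ Icc (η/4) (3*η/4)) →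
        (∀ i, w' i ∈ Icc (η/4) (3*η/4)) → ‖g₁ w - g₁ w'‖ ≤ θ * ‖w - w'‖) →
      (∀ w : Fin u → ℝ, (∀ i, w i ∈ Icc (η/4) (3*η/4)) →
        (∀ i, (g₁ w).1 i ∈ Icc (0:ℝ) 1) ∧ (∀ i, (g₁ w).2 i ∈ Icc (0:ℝ) 1)) →
      -- `g₂, g₃` are `α`-Lipschitz on `[0,1]^s` with values in `[0,1]^c × [0,1]^u`
      (∀ z z' : Fin s → ℝ, (∀ i, z i ∈ Icc (0:ℝ) 1) → (∀ i, z' i ∈ Icc (0:ℝ) 1) →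
        ‖g₂ z - g₂ z'‖ ≤ α * ‖z - z'‖ ∧ ‖g₃ z - g₃ z'‖ ≤ α * ‖z - z'‖) →
      (∀ z : Fin s → ℝ, (∀ i, z i ∈ Icc (0:ℝ) 1) →
        (∀ i, (g₂ z).1 i ∈ Icc (0:ℝ) 1) ∧ (∀ i, (g₂ z).2 i ∈ Icc (0:ℝ) 1) ∧
        (∀ i, (g₃ z).1 i ∈ Icc (0:ℝ) 1) ∧ (∀ i, (g₃ z).2 i ∈ Icc (0:ℝ) 1)) →
      -- `ϑ₂` intersects `ϑ₁`
      (∃ z w, (∀ i, z i ∈ Icc (0:ℝ) 1) ∧ (∀ i, w i ∈ Icc (η/4) (3*η/4)) ∧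
        ((z, g₂ z) : (Fin s → ℝ) × (Fin c → ℝ) × (Fin u → ℝ)) =
          ((g₁ w).1, (g₁ w).2, w)) →
      -- `ϑ₃` intersects `ϑ₁`
      (∃ z w, (∀ i, z i ∈ Icc (0:ℝ) 1) ∧ (∀ i, w i ∈ Icc (η/4) (3*η/4)) ∧
        ((z, g₃ z) : (Fin s → ℝ) × (Fin c → ℝ) × (Fin u → ℝ)) =
          ((g₁ w).1, (g₁ w).2, w)) →
      -- conclusion: any two points of `ϑ₂ ∪ ϑ₃` have close center components
      ∀ p q : (Fin s → ℝ) × (Fin c → ℝ) × (Fin u → ℝ),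
        (∃ z, (∀ i, z i ∈ Icc (0:ℝ) 1) ∧ (p = (z, g₂ z) ∨ p = (z, g₃ z))) →
        (∃ z, (∀ i, z i ∈ Icc (0:ℝ) 1) ∧ (q = (z, g₂ z) ∨ q = (z, g₃ z))) →
        ‖p.2.1 - q.2.1‖ ≤ κ * η / 20 := by
  have hθκ' : θ < κ / 10 := hθκ.trans_le (min_le_left _ _)
  have hα : 0 < η / 2 * (κ / 20 - θ / 2) := mul_pos (by linarith) (by linarith)
  refine ⟨η / 2 * (κ / 20 - θ / 2), hα, ?_⟩
  intro g₁ g₂ g₃ hg₁ _ hg _ h₂ h₃ p q hp hq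
  obtain ⟨z₂, w₂, hz₂, hw₂, e₂⟩ := h₂
  obtain ⟨z₃, w₃, hz₃, hw₃, e₃⟩ := h₃
  have near : ∀ r : (Fin s → ℝ) × (Fin c → ℝ) × (Fin u → ℝ),
      (∃ z, (∀ i, z i ∈ Icc (0:ℝ) 1) ∧ (r = (z, g₂ z) ∨ r = (z, g₃ z))) →
      ∃ w : Fin u → ℝ, (∀ i, w i ∈ Icc (η/4) (3*η/4)) ∧
        ‖r.2.1 - (g₁ w).2‖ ≤ η / 2 * (κ / 20 - θ / 2) := by
    rintro r ⟨z, hz, rfl | rfl⟩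
    · have e : (g₂ z₂).1 = (g₁ w₂).2 := congrArg (fun x => x.2.1) e₂
      refine ⟨w₂, hw₂, e ▸ ?_⟩
      exact norm_fst_sub_le_of_lipschitz hα.le (fun a b ha hb => (hg a b ha hb).1) hz hz₂
    · have e : (g₃ z₃).1 = (g₁ w₃).2 := congrArg (fun x => x.2.1) e₃
      refine ⟨w₃, hw₃, e ▸ ?_⟩
      exact norm_fst_sub_le_of_lipschitz hα.le (fun a b ha hb => (hg a b ha hb).2) hz hz₃
  obtain ⟨w, hw, hpw⟩ := near p hp
  obtain ⟨w', hw', hqw⟩ := near q hq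
  have hww : ‖w - w'‖ ≤ 3 * η / 4 - η / 4 :=
    norm_sub_le_of_forall_mem_Icc (by linarith) hw hw'
  have hg₁c : ‖(g₁ w).2 - (g₁ w').2‖ ≤ θ * (3 * η / 4 - η / 4) :=
    calc ‖(g₁ w).2 - (g₁ w').2‖ ≤ ‖g₁ w - g₁ w'‖ := norm_snd_le (g₁ w - g₁ w')
      _ ≤ θ * ‖w - w'‖ := hg₁ w w' hw hw'
      _ ≤ θ * (3 * η / 4 - η / 4) := by gcongr
  rw [norm_sub_rev] at hqw
  have t₁ := norm_sub_le_norm_sub_add_norm_sub p.2.1 (g₁ w).2 q.2.1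
  have t₂ := norm_sub_le_norm_sub_add_norm_sub (g₁ w).2 (g₁ w').2 q.2.1
  linarith
end

section
/- For every integer d ≥ 1, every real Δ ≥ 1, every real ξ > 0 and every integer N ≥ 0 there exists an integer I, depending only on d, N, Δ and ξ (any I > (N+1) · ξ · max{1, (√d · Δ^N)^d} works), with the following property. Let h : ℝ^d → ℝ^d be a Δ-Lipschitz map (for the Euclidean norm), let U ⊆ ℝ^d, let ρ > 0, and let F ⊆ ℝ^d be a finite set such that for every ε > 0 and every Euclidean ball B of radius ε intersecting U one has #{z ∈ F : (z + [−ρ, ρ]^d) ∩ B ≠ ∅} ≤ ξ · max{1, (ε/ρ)^d}. Then for every x ∈ F such that h^i(x) ∈ U for all 0 ≤ i ≤ N, one has #{y ∈ F : (y + [−ρ, ρ]^d) ∩ (⋃_{i=0}^{N} h^i(x + [−ρ/2, ρ/2]^d)) ≠ ∅} < I. -/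
open Set Metric

theorem EuclideanSpace.dist_le_sqrt_mul_of_forall_abs_sub_le {d : ℕ} {r : ℝ} (hr : 0 ≤ r)
    {w x : EuclideanSpace ℝ (Fin d)} (hw : ∀ j, |w j - x j| ≤ r) :
    dist w x ≤ Real.sqrt d * r := by
  rw [EuclideanSpace.dist_eq]
  calc Real.sqrt (∑ j, dist (w j) (x j) ^ 2) ≤ Real.sqrt (∑ _j : Fin d, r ^ 2) := by
        gcongr with j
        exact hw j
    _ = Real.sqrt d * r := by simp [Real.sqrt_sq hr]

theorem dist_iterate_le_pow_mul {X : Type*} [PseudoMetricSpace X] {h : X → X} {K : ℝ}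
    (hK : 0 ≤ K) (hh : ∀ x y, dist (h x) (h y) ≤ K * dist x y) (n : ℕ) (x y : X) :
    dist (h^[n] x) (h^[n] y) ≤ K ^ n * dist x y := by
  simpa [Real.coe_toNNReal K hK] using ((LipschitzWith.of_dist_le_mul (K := K.toNNReal)
    (by simpa [Real.coe_toNNReal K hK] using hh)).iterate n).dist_le_mul x y

/-- **Lemma 5.9 (Lema-BoundedIntersectionIterates)** of Crovisier–Potrie–Sambarino, Euclidean
version. Given `d ≥ 1`, `Δ ≥ 1`, `ξ > 0` and `N ≥ 0`, there is an integer `I` (any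
`I > (N+1) · ξ · max{1, (√d · Δ^N)^d}` works) with the following property: for every
`Δ`-Lipschitz map `h` of `ℝ^d`, every set `U`, every `ρ > 0` and every finite set `F`
satisfying the counting property (b) of a `ξ`-covering of size `ρ` of `U`, and every `x ∈ F`
whose first `N` iterates stay in `U`, the number of `y ∈ F` whose cube `y + [−ρ,ρ]^d` meets
`⋃_{i≤N} h^i(x + [−ρ/2,ρ/2]^d)` is less than `I`. -/
theorem stmt_3 (d : ℕ) (hd : 1 ≤ d) (Δ : ℝ) (hΔ : 1 ≤ Δ) (ξ : ℝ) (hξ : 0 < ξ) (N : ℕ) :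
    ∀ I : ℕ, (N + 1 : ℝ) * ξ * max 1 ((Real.sqrt d * Δ^N)^d) < I →
      ∀ h : EuclideanSpace ℝ (Fin d) → EuclideanSpace ℝ (Fin d),
        (∀ x y, dist (h x) (h y) ≤ Δ * dist x y) →
      ∀ (U : Set (EuclideanSpace ℝ (Fin d))) (ρ : ℝ), 0 < ρ →
      ∀ F : Set (EuclideanSpace ℝ (Fin d)), F.Finite →
        (∀ ε : ℝ, 0 < ε → ∀ p : EuclideanSpace ℝ (Fin d),
          (closedBall p ε ∩ U).Nonempty →
          ({z ∈ F | ∃ w ∈ closedBall p ε, ∀ i, |w i - z i| ≤ ρ}).ncard ≤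
            ξ * max 1 ((ε/ρ)^d)) →
      ∀ x ∈ F, (∀ i : ℕ, i ≤ N → h^[i] x ∈ U) →
        ({y ∈ F | ∃ q : EuclideanSpace ℝ (Fin d),
            (∃ i ≤ N, ∃ w : EuclideanSpace ℝ (Fin d),
              (∀ j, |w j - x j| ≤ ρ/2) ∧ q = h^[i] w) ∧
            ∀ j, |q j - y j| ≤ ρ}).ncard < I := by
  intro I hI h hh U ρ hρ F hF hcount x _ hxU
  have hd' : 0 < Real.sqrt d := Real.sqrt_pos.2 (by exact_mod_cast hd)
  set ε := Real.sqrt d * Δ ^ N * ρ with hε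
  have hεpos : 0 < ε := by positivity
  let A : ℕ → Set (EuclideanSpace ℝ (Fin d)) := fun i ↦
    {z ∈ F | ∃ w ∈ closedBall (h^[i] x) ε, ∀ j, |w j - z j| ≤ ρ}
  have hA : ∀ i ∈ Finset.range (N + 1),
      ((A i).ncard : ℝ) ≤ ξ * max 1 ((Real.sqrt d * Δ ^ N) ^ d) := by
    intro i hi
    have hc := hcount ε hεpos (h^[i] x)
      ⟨h^[i] x, mem_closedBall_self hεpos.le, hxU i (Finset.mem_range_succ_iff.1 hi)⟩
    rwa [hε, mul_div_cancel_right₀ _ hρ.ne'] at hc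
  have hsub : {y ∈ F | ∃ q : EuclideanSpace ℝ (Fin d),
      (∃ i ≤ N, ∃ w : EuclideanSpace ℝ (Fin d),
        (∀ j, |w j - x j| ≤ ρ/2) ∧ q = h^[i] w) ∧
      ∀ j, |q j - y j| ≤ ρ} ⊆ ⋃ i ∈ Finset.range (N + 1), A i := by
    rintro y ⟨hy, q, ⟨i, hi, w, hw, rfl⟩, hq⟩
    refine mem_iUnion₂.2 ⟨i, Finset.mem_range_succ_iff.2 hi, hy, h^[i] w, mem_closedBall.2 ?_, hq⟩
    calc dist (h^[i] w) (h^[i] x) ≤ Δ ^ i * dist w x :=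
          dist_iterate_le_pow_mul (zero_le_one.trans hΔ) hh i w x
      _ ≤ Δ ^ N * (Real.sqrt d * ρ) := by
          gcongr
          exact EuclideanSpace.dist_le_sqrt_mul_of_forall_abs_sub_le hρ.le
            fun j ↦ (hw j).trans (half_le_self hρ.le)
      _ = ε := by rw [hε]; ring
  have hfin : (⋃ i ∈ Finset.range (N + 1), A i).Finite :=
    hF.subset (iUnion₂_subset fun i _ ↦ sep_subset _ _)
  have hcard := (ncard_le_ncard hsub hfin).trans (Finset.set_ncard_biUnion_le _ A)
  have hsum := Finset.sum_le_card_nsmul _ _ _ hA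
  rw [Finset.card_range, nsmul_eq_mul, Nat.cast_succ, ← mul_assoc] at hsum
  have := (Nat.cast_le (α := ℝ)).2 hcard
  rw [Nat.cast_sum] at this
  exact_mod_cast (this.trans hsum).trans_lt hI
end

section
/- For all integers s, u ≥ 1 and every real Δ ≥ 1, there exist a positive integer L and a family 𝒞 of tiles in ℝ^s × [0,L]^u such that: (i) each tile Q ∈ 𝒞 is of the form (a, b) + [0,1]^s × [0,1]^u with a ∈ ℝ^s and b ∈ {0, …, L−1}^u; (ii) any two distinct tiles Q, Q' ∈ 𝒞 contained in ℝ^s × (b + [0,1]^u) for the same b ∈ {0, …, L−1}^u satisfy dist(Q, Q') > 3^{s+u} · Δ (Euclidean distance between the two sets); (iii) for every α with 0 < α < 1/(4L) and every α-Lipschitz map f : [0,L]^u → ℝ^s (with respect to the sup-norms), the graph {(f(w), w) : w ∈ [0,L]^u} intersects ½Q for some Q ∈ 𝒞. -/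
open Set

/-- Euclidean distance between two points of `ℝ^s × ℝ^u` (viewed inside `ℝ^{s+u}`). -/
noncomputable def euclDistProd {s u : ℕ} (p q : (Fin s → ℝ) × (Fin u → ℝ)) : ℝ :=
  Real.sqrt (∑ i, (p.1 i - q.1 i)^2 + ∑ j, (p.2 j - q.2 j)^2)

/-- A single coordinate difference bounds `euclDistProd` from below. -/
lemma abs_sub_le_euclDistProd {s u : ℕ} (p q : (Fin s → ℝ) × (Fin u → ℝ)) (i : Fin s) :
    |p.1 i - q.1 i| ≤ euclDistProd p q := by
  unfold euclDistProd
  rw [← Real.sqrt_sq_eq_abs]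
  apply Real.sqrt_le_sqrt
  have h := Finset.single_le_sum (f := fun i => (p.1 i - q.1 i)^2)
    (fun _ _ => sq_nonneg _) (Finset.mem_univ i)
  have h' : 0 ≤ ∑ j, (p.2 j - q.2 j)^2 := Finset.sum_nonneg fun _ _ => sq_nonneg _
  linarith

/-- Distinct integer vectors with the same residues modulo `M` differ by at least `M` in some
coordinate. -/
lemma exists_le_abs_sub_of_intCast_eq {ι : Type*} {M : ℕ} {k k' : ι → ℤ}
    (hne : k ≠ k') (h : ∀ i, (k i : ZMod M) = k' i) :
    ∃ i, (M : ℝ) ≤ |(k i : ℝ) - k' i| := by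
  obtain ⟨i, hi⟩ := Function.ne_iff.mp hne
  refine ⟨i, ?_⟩
  have hdvd : (M : ℤ) ∣ k i - k' i := (ZMod.intCast_eq_intCast_iff_dvd_sub _ _ _).mp (h i).symm
  exact_mod_cast Int.le_of_dvd (abs_pos.mpr (sub_ne_zero.mpr hi)) ((dvd_abs _ _).mpr hdvd)

/-- **Proposition 5.11 (Prop-Colorings)** of Crovisier–Potrie–Sambarino.
For `s, u ≥ 1` and `Δ ≥ 1` there are `L > 0` and a family `𝒞` of tiles
`(a,b) + [0,1]^s × [0,1]^u` (with `a ∈ ℝ^s`, `b ∈ {0,…,L−1}^u`) in `ℝ^s × [0,L]^u` such that: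
(ii) two distinct tiles in the same row (same `b`) are at Euclidean distance `> 3^{s+u}·Δ`;
(iii) for `0 < α < 1/(4L)`, the graph of any `α`-Lipschitz map `[0,L]^u → ℝ^s` (sup-norms)
meets the middle half `½Q` of some tile `Q ∈ 𝒞`. A tile is encoded by its corner
`v = (a, b) ∈ (Fin s → ℝ) × (Fin u → ℕ)`. -/
theorem stmt_4 (s u : ℕ) (hs : 1 ≤ s) (hu : 1 ≤ u) (Δ : ℝ) (hΔ : 1 ≤ Δ) :
    ∃ L : ℕ, 0 < L ∧ ∃ 𝒞 : Set ((Fin s → ℝ) × (Fin u → ℕ)),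
      -- (i) the corners `b` lie in `{0, …, L−1}^u`
      (∀ v ∈ 𝒞, ∀ j, v.2 j < L) ∧
      -- (ii) separation of distinct tiles in the same row
      (∀ v ∈ 𝒞, ∀ v' ∈ 𝒞, v.2 = v'.2 → v.1 ≠ v'.1 →
        ∀ p q : (Fin s → ℝ) × (Fin u → ℝ),
          (∀ i, p.1 i ∈ Icc (v.1 i) (v.1 i + 1)) →
          (∀ j, p.2 j ∈ Icc (v.2 j : ℝ) ((v.2 j : ℝ) + 1)) →
          (∀ i, q.1 i ∈ Icc (v'.1 i) (v'.1 i + 1)) →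
          (∀ j, q.2 j ∈ Icc (v'.2 j : ℝ) ((v'.2 j : ℝ) + 1)) →
          3^(s+u) * Δ < euclDistProd p q) ∧
      -- (iii) every almost-horizontal Lipschitz graph meets the middle half of some tile
      (∀ α : ℝ, 0 < α → α < 1/(4*L) →
        ∀ f : (Fin u → ℝ) → (Fin s → ℝ),
          (∀ w w' : Fin u → ℝ, (∀ j, w j ∈ Icc (0:ℝ) L) → (∀ j, w' j ∈ Icc (0:ℝ) L) →
            ‖f w - f w'‖ ≤ α * ‖w - w'‖) →
          ∃ v ∈ 𝒞, ∃ w : Fin u → ℝ, (∀ j, w j ∈ Icc (0:ℝ) L) ∧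
            (∀ i, f w i ∈ Icc (v.1 i + 1/4) (v.1 i + 3/4)) ∧
            (∀ j, w j ∈ Icc ((v.2 j : ℝ) + 1/4) ((v.2 j : ℝ) + 3/4))) := by
  obtain ⟨M, hM⟩ := exists_nat_gt (4 * (3^(s+u) * Δ + 1))
  have hM0 : M ≠ 0 := by
    rintro rfl
    have : 0 ≤ 3^(s+u) * Δ := by positivity
    norm_num at hM
    linarith
  have : NeZero M := ⟨hM0⟩
  let color : (Fin s → ℤ) → Fin (Fintype.card (Fin s → ZMod M)) :=
    fun k => Fintype.equivFin (Fin s → ZMod M) fun i => (k i : ZMod M)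
  refine ⟨Fintype.card (Fin s → ZMod M), Fintype.card_pos,
    range fun k : Fin s → ℤ => (fun i => (k i : ℝ) / 4, fun _ => (color k : ℕ)), ?_, ?_, ?_⟩
  · rintro _ ⟨k, rfl⟩ j
    exact (color k).isLt
  · rintro _ ⟨k, rfl⟩ _ ⟨k', rfl⟩ hb ha p q hp - hq -
    have hcol : color k = color k' := Fin.ext (congrFun hb ⟨0, hu⟩)
    have hres := (Fintype.equivFin (Fin s → ZMod M)).injective hcol
    obtain ⟨i, hi⟩ := exists_le_abs_sub_of_intCast_eq
      (fun h => ha (by simp [h])) (congrFun hres)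
    refine lt_of_lt_of_le ?_ (abs_sub_le_euclDistProd p q i)
    obtain ⟨hp1, hp2⟩ := hp i
    obtain ⟨hq1, hq2⟩ := hq i
    simp only at hp1 hp2 hq1 hq2
    rw [lt_abs]
    rcases le_abs.mp hi with h | h
    · left; linarith
    · right; linarith
  · have hL : (0 : ℝ) < Fintype.card (Fin s → ZMod M) := Nat.cast_pos.mpr Fintype.card_pos
    intro α hα hαL f hf
    generalize hLdef : (Fintype.card (Fin s → ZMod M) : ℝ) = L at *
    let k : Fin s → ℤ := fun i => round (4 * (f (fun _ => L / 2) i - 1/2))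
    have hc : ((color k : ℕ) : ℝ) + 1 ≤ L := by
      rw [← hLdef]
      exact_mod_cast (color k).isLt
    have hc0 : (0 : ℝ) ≤ ((color k : ℕ) : ℝ) := Nat.cast_nonneg _
    refine ⟨_, ⟨k, rfl⟩, fun _ => ((color k : ℕ) : ℝ) + 1/2, fun _ => ⟨by linarith, by linarith⟩,
      fun i => ?_, fun j => ⟨by simp only; linarith, by simp only; linarith⟩⟩
    have hround := abs_le.mp (abs_sub_round (4 * (f (fun _ => L / 2) i - 1/2)))
    have hdist := hf (fun _ => ((color k : ℕ) : ℝ) + 1/2) (fun _ => L / 2)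
      (fun _ => ⟨by linarith, by linarith⟩) (fun _ => ⟨by linarith, by linarith⟩)
    have hnorm : ‖(fun _ : Fin u => ((color k : ℕ) : ℝ) + 1/2) - fun _ => L / 2‖ ≤ L / 2 := by
      refine (pi_norm_le_iff_of_nonneg (by linarith)).mpr fun j => ?_
      rw [Real.norm_eq_abs, abs_le]
      constructor <;> simp only [Pi.sub_apply] <;> linarith
    have hαL' : α * (4 * L) < 1 := (lt_div_iff₀ (by linarith)).mp hαL
    have hmul := mul_le_mul_of_nonneg_left hnorm hα.le
    have hcoord := norm_le_pi_norm (f (fun _ => ((color k : ℕ) : ℝ) + 1/2) - f fun _ => L / 2) i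
    rw [Pi.sub_apply, Real.norm_eq_abs] at hcoord
    have hdrift := abs_le.mp (hcoord.trans (show _ ≤ (1 / 8 : ℝ) by linarith only [hdist, hmul, hαL']))
    change _ ∈ Icc ((round (4 * (f (fun _ => L / 2) i - 1/2)) : ℝ) / 4 + 1/4)
      ((round (4 * (f (fun _ => L / 2) i - 1/2)) : ℝ) / 4 + 3/4)
    constructor <;> linarith [hdrift.1, hdrift.2, hround.1, hround.2]
end

section
/- Fix integers s, u ≥ 1 and an integer L ≥ 1. Let 𝒞 be a family of tiles in ℝ^s × [0,L]^u, each of the form Q = v + [0,1]^s × [0,1]^u, such that for every x ∈ ℝ^s there exists a tile Q = v + [0,1]^s × [0,1]^u in 𝒞 with ({x} × [0,L]^u) ∩ (v + [3/8, 5/8]^s × [3/8, 5/8]^u) ≠ ∅. Then for every α with 0 < α ≤ 1/(4L) and every α-Lipschitz map f : [0,L]^u → ℝ^s (with respect to the sup-norms), the graph {(f(w), w) : w ∈ [0,L]^u} intersects ½Q for some Q ∈ 𝒞. -/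
open Set

/-- The implication (iii)′ ⇒ (iii) in the proof of **Proposition 5.11** of
Crovisier–Potrie–Sambarino. Let `𝒞` be a family of tiles `v + [0,1]^s × [0,1]^u` in
`ℝ^s × [0,L]^u` (tiles encoded by corners `v ∈ (Fin s → ℝ) × (Fin u → ℝ)`). If every
vertical segment `{x} × [0,L]^u` meets the central quarter `¼Q` of some tile `Q ∈ 𝒞`, then
for every `0 < α ≤ 1/(4L)`, the graph of every `α`-Lipschitz map `f : [0,L]^u → ℝ^s`
(sup-norms) meets the central half `½Q` of some tile `Q ∈ 𝒞`. -/
theorem stmt_5 (s u : ℕ) (hs : 1 ≤ s) (hu : 1 ≤ u) (L : ℕ) (hL : 1 ≤ L)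
    (𝒞 : Set ((Fin s → ℝ) × (Fin u → ℝ)))
    -- the tiles lie in `ℝ^s × [0,L]^u`
    (h𝒞sub : ∀ v ∈ 𝒞, ∀ j : Fin u, 0 ≤ v.2 j ∧ v.2 j + 1 ≤ L)
    -- (iii)′ : every vertical segment `{x} × [0,L]^u` meets the quarter `¼Q` of some tile
    (h𝒞 : ∀ x : Fin s → ℝ, ∃ v ∈ 𝒞, ∃ w : Fin u → ℝ,
      (∀ j, w j ∈ Icc (0:ℝ) L) ∧
      (∀ i, x i ∈ Icc (v.1 i + 3/8) (v.1 i + 5/8)) ∧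
      (∀ j, w j ∈ Icc (v.2 j + 3/8) (v.2 j + 5/8)))
    (α : ℝ) (hα0 : 0 < α) (hα : α ≤ 1/(4*L))
    (f : (Fin u → ℝ) → (Fin s → ℝ))
    (hf : ∀ w w' : Fin u → ℝ, (∀ j, w j ∈ Icc (0:ℝ) L) → (∀ j, w' j ∈ Icc (0:ℝ) L) →
      ‖f w - f w'‖ ≤ α * ‖w - w'‖) :
    ∃ v ∈ 𝒞, ∃ w : Fin u → ℝ, (∀ j, w j ∈ Icc (0:ℝ) L) ∧
      (∀ i, f w i ∈ Icc (v.1 i + 1/4) (v.1 i + 3/4)) ∧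
      (∀ j, w j ∈ Icc (v.2 j + 1/4) (v.2 j + 3/4)) := by
  have hL' : (1 : ℝ) ≤ L := by exact_mod_cast hL
  set c : Fin u → ℝ := fun _ => (L : ℝ) / 2 with hc
  have hcmem : ∀ j, c j ∈ Icc (0 : ℝ) L := fun j => ⟨by simp only [hc]; linarith, by
    simp only [hc]; linarith⟩
  obtain ⟨v, hv, w, hw, hx, hwv⟩ := h𝒞 (f c)
  have hdist : ‖w - c‖ ≤ L / 2 := by
    refine (pi_norm_le_iff_of_nonneg (by positivity)).2 fun j => ?_
    obtain ⟨h₀, h₁⟩ := hw j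
    rw [Pi.sub_apply, Real.norm_eq_abs, abs_le]
    constructor <;> simp only [hc] <;> linarith
  have hαL : α * (L / 2) ≤ 1 / 8 := by
    rw [le_div_iff₀ (by positivity)] at hα
    linarith
  have hclose : ‖f w - f c‖ ≤ 1 / 8 :=
    (hf w c hw hcmem).trans ((mul_le_mul_of_nonneg_left hdist hα0.le).trans hαL)
  refine ⟨v, hv, w, hw, fun i => ?_, fun j => ?_⟩
  · have hi := (norm_le_pi_norm (f w - f c) i).trans hclose
    rw [Pi.sub_apply, Real.norm_eq_abs, abs_le] at hi
    obtain ⟨h₀, h₁⟩ := hx i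
    constructor <;> linarith [hi.1, hi.2]
  · obtain ⟨h₀, h₁⟩ := hwv j
    constructor <;> linarith
end

section
/- Let k ≥ 2 be an integer. In ℝ^k with the Euclidean norm, let B = {x ∈ ℝ^k : ‖x‖ < 1} be the open unit ball, let D = {x ∈ ℝ^k : x_k = 0 and ‖x‖ ≤ 1/2} be the closed (k−1)-dimensional disc of radius 1/2 in the hyperplane ℝ^{k−1} × {0}, and let β = {x ∈ ℝ^k : x₁ = ⋯ = x_{k−1} = 0 and x_k ∈ [−1/2, 1/2]} be the vertical segment. If b : β → B and h : D → B are continuous maps with ‖b(p) − p‖ ≤ 1/8 for every p ∈ β and ‖h(q) − q‖ ≤ 1/8 for every q ∈ D, then the images intersect: b(β) ∩ h(D) ≠ ∅. -/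
open Set

open MeasureTheory Metric Module

section Brouwer

variable {E : Type*} [NormedAddCommGroup E] [InnerProductSpace ℝ E] [FiniteDimensional ℝ E]

/-- `t ↦ det (1 + t A)` is a polynomial of degree at most `dim E`, so its value at `1` is given by
Lagrange interpolation at more than `dim E` nodes. -/
theorem det_one_add_eq_sum_lagrange (A : E →L[ℝ] E) {s : Finset ℕ} {v : ℕ → ℝ}
    (hv : Set.InjOn v s) (hs : finrank ℝ E < s.card) :
    (1 + A).det =
      ∑ i ∈ s, (1 + v i • A).det * (Lagrange.basis s v i).eval 1 := by
  let e := finBasis ℝ E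
  let M := LinearMap.toMatrix e e (A : E →ₗ[ℝ] E)
  let p : Polynomial ℝ := Matrix.det ((Polynomial.X : Polynomial ℝ) • M.map Polynomial.C +
    (1 : Matrix _ _ ℝ).map Polynomial.C)
  have hp (t : ℝ) : p.eval t = (1 + t • A).det := by
    rw [ContinuousLinearMap.det, ← LinearMap.det_toMatrix e]
    have h : p.eval t = _ := (Polynomial.evalRingHom t).map_det _
    rw [h]
    congr 1
    have h1 : LinearMap.toMatrix e e ((1 + t • A : E →L[ℝ] E) : E →ₗ[ℝ] E) = 1 + t • M := by
      rw [show ((1 + t • A : E →L[ℝ] E) : E →ₗ[ℝ] E) = 1 + t • (A : E →ₗ[ℝ] E) from rfl, map_add,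
        map_smul, LinearMap.toMatrix_one]
    rw [h1]
    ext i j
    by_cases hij : i = j <;> simp [hij] <;> ring
  have hdeg : p.degree < s.card := by
    refine Polynomial.degree_le_natDegree.trans_lt ?_
    have := Polynomial.natDegree_det_X_add_C_le M 1
    rw [Fintype.card_fin] at this
    exact_mod_cast this.trans_lt hs
  have h := congrArg (Polynomial.eval 1) (Lagrange.eq_interpolate hv hdeg)
  rw [hp, one_smul, Lagrange.interpolate_apply, Polynomial.eval_finsetSum] at h
  simpa [hp] using h

/-- If `g` is Lipschitz on the closed unit ball and vanishes on the unit sphere, then for small `t`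
the map `x ↦ x + t • g x` permutes the closed unit ball as soon as it preserves it. -/
theorem bijOn_closedBall_add_smul {g : E → E} {K : NNReal}
    (hg : LipschitzOnWith K g (closedBall 0 1)) (h0 : ∀ x, ‖x‖ = 1 → g x = 0) {t : ℝ}
    (ht : 0 ≤ t) (htK : t * (2 * K) < 1)
    (hmaps : MapsTo (fun x ↦ x + t • g x) (closedBall 0 1) (closedBall 0 1)) :
    BijOn (fun x ↦ x + t • g x) (closedBall 0 1) (closedBall 0 1) := by
  let G : E → E := fun x ↦ if ‖x‖ ≤ 1 then g x else 0
  have hmix (x y : E) (hx : ‖x‖ ≤ 1) (hy : 1 < ‖y‖) : ‖g x‖ ≤ 2 * K * ‖x - y‖ := by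
    have hy0 : (0 : ℝ) < ‖y‖ := by linarith
    have hz : ‖‖y‖⁻¹ • y‖ = 1 := by
      rw [norm_smul, norm_inv, norm_norm, inv_mul_cancel₀ hy0.ne']
    have h1 := hg.dist_le_mul x (by simpa using hx) (‖y‖⁻¹ • y) (by simp [hz])
    rw [h0 _ hz, dist_zero_right, dist_eq_norm] at h1
    have h2 : ‖y - ‖y‖⁻¹ • y‖ = ‖y‖ - 1 := by
      have : y - ‖y‖⁻¹ • y = (1 - ‖y‖⁻¹) • y := by rw [sub_smul, one_smul]
      rw [this, norm_smul, Real.norm_of_nonneg (sub_nonneg.2 (inv_le_one_of_one_le₀ hy.le)),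
        sub_mul, inv_mul_cancel₀ hy0.ne', one_mul]
    have h3 : ‖y‖ - ‖x‖ ≤ ‖x - y‖ := by
      rw [norm_sub_rev]; exact norm_sub_norm_le y x
    have h4 : ‖x - ‖y‖⁻¹ • y‖ ≤ ‖x - y‖ + ‖y - ‖y‖⁻¹ • y‖ := norm_sub_le_norm_sub_add_norm_sub ..
    calc ‖g x‖ ≤ K * ‖x - ‖y‖⁻¹ • y‖ := h1
      _ ≤ K * (2 * ‖x - y‖) := by gcongr; linarith
      _ = _ := by ring
  have hG (x y : E) : ‖G x - G y‖ ≤ 2 * K * ‖x - y‖ := by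
    by_cases hx : ‖x‖ ≤ 1 <;> by_cases hy : ‖y‖ ≤ 1
    · have := hg.dist_le_mul x (by simpa using hx) y (by simpa using hy)
      simp only [G, hx, hy, if_true, ← dist_eq_norm]
      have : 0 ≤ (K : ℝ) * dist x y := by positivity
      linarith
    · simpa [G, hx, hy] using hmix x y hx (not_le.1 hy)
    · rw [norm_sub_rev x]
      simpa [G, hx, hy] using hmix y x hy (not_le.1 hx)
    · simp only [G, hx, hy, if_false, sub_self, norm_zero]
      positivity
  let c : NNReal := t.toNNReal * (2 * K)
  have happ : ApproximatesLinearOn (fun x ↦ x + t • G x)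
      ((ContinuousLinearEquiv.refl ℝ E : E ≃L[ℝ] E) : E →L[ℝ] E) univ c := by
    intro x _ y _
    have : x + t • G x - (y + t • G y) - (x - y) = t • (G x - G y) := by
      rw [smul_sub]; abel
    simp only [ContinuousLinearEquiv.coe_refl, ContinuousLinearMap.id_apply]
    rw [this, norm_smul, Real.norm_of_nonneg ht]
    calc t * ‖G x - G y‖ ≤ t * (2 * K * ‖x - y‖) := by gcongr; exact hG x y
      _ = _ := by simp [c, ht]; ring
  have hc : Subsingleton E ∨ c < ‖((ContinuousLinearEquiv.refl ℝ E).symm : E →L[ℝ] E)‖₊⁻¹ := by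
    rcases subsingleton_or_nontrivial E with h | h
    · exact .inl h
    · right
      have : ‖((ContinuousLinearEquiv.refl ℝ E).symm : E →L[ℝ] E)‖₊ = 1 := by
        ext; simp
      rw [this, inv_one, ← NNReal.coe_lt_coe]
      simpa [c, ht] using htK
  have heq : EqOn (fun x ↦ x + t • G x) (fun x ↦ x + t • g x) (closedBall 0 1) := by
    intro x hx
    have : ‖x‖ ≤ 1 := by simpa using hx
    simp [G, this]
  refine ⟨hmaps, ?_, ?_⟩
  · exact ((happ.injOn hc).mono (subset_univ _)).congr heq
  · intro y hy
    obtain ⟨x, hx⟩ := happ.surjective hc y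
    by_cases hx1 : ‖x‖ ≤ 1
    · exact ⟨x, by simpa using hx1, by rw [← hx]; exact (heq (by simpa using hx1)).symm⟩
    · simp only [G, hx1, if_false, smul_zero, add_zero] at hx
      subst hx
      simp at hy
      exact absurd hy hx1

/-- There is no `C^1` retraction of a ball onto its boundary sphere. -/
theorem not_exists_contDiff_retraction_sphere {r : E → E} (hr : ContDiff ℝ 1 r)
    (hr1 : ∀ x, ‖r x‖ = 1) (hid : ∀ x, ‖x‖ = 1 → r x = x) : False := by
  borelize E
  let g : E → E := fun x ↦ r x - x
  have hg : ContDiff ℝ 1 g := hr.sub contDiff_id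
  have hcpt : IsCompact (closedBall (0 : E) 1) := isCompact_closedBall 0 1
  obtain ⟨K, hK⟩ := LocallyLipschitzOn.exists_lipschitzOnWith_of_compact hcpt
    hg.locallyLipschitz.locallyLipschitzOn
  have hg0 : ∀ x, ‖x‖ = 1 → g x = 0 := fun x hx ↦ by simp [g, hid x hx]
  have hgd : Continuous (fderiv ℝ g) := hg.continuous_fderiv one_ne_zero
  have hdet : Continuous fun A : E →L[ℝ] E ↦ A.det := ContinuousLinearMap.continuous_det
  have hpos : ∃ ε > 0, ∀ A : E →L[ℝ] E, ‖A‖ < ε → 0 < (1 + A).det := by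
    have h1 : {A : E →L[ℝ] E | 0 < (1 + A).det} ∈ nhds (0 : E →L[ℝ] E) := by
      refine (isOpen_lt continuous_const
        (hdet.comp (continuous_const.add continuous_id))).mem_nhds ?_
      have : ((1 : E →L[ℝ] E)).det = 1 := by
        rw [ContinuousLinearMap.det, ContinuousLinearMap.toLinearMap_one, map_one]
      simp [this]
    obtain ⟨ε, hε, h⟩ := Metric.mem_nhds_iff.1 h1
    exact ⟨ε, hε, fun A hA ↦ h (by simpa using hA)⟩
  obtain ⟨ε, hε, hpos⟩ := hpos
  obtain ⟨M, hM⟩ := hcpt.exists_bound_of_continuousOn hgd.continuousOn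
  obtain ⟨δ, hδ, hδ1, hδK, hδM⟩ : ∃ δ : ℝ, 0 < δ ∧ δ ≤ 1 ∧ δ * (2 * K) < 1 ∧ δ * |M| < ε := by
    have l (a b : ℝ) (hb : 0 < b) : ∀ᶠ δ : ℝ in nhdsWithin 0 (Ioi 0), δ * a < b := by
      apply Filter.Eventually.filter_mono nhdsWithin_le_nhds
      exact (continuous_id.mul continuous_const).continuousAt.eventually_lt continuousAt_const
        (by simpa using hb)
    obtain ⟨δ, h1, h2, h3, h4⟩ := ((l 1 1 one_pos).and ((l (2 * K) 1 one_pos).and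
      ((l |M| ε hε).and self_mem_nhdsWithin))).exists
    exact ⟨δ, h4, by linarith, h2, h3⟩
  have hvol (t : ℝ) (ht : 0 < t) (htδ : t ≤ δ) :
      ∫ x in closedBall (0 : E) 1, (1 + t • fderiv ℝ g x).det =
        (volume (closedBall (0 : E) 1)).toReal := by
    have hmaps : MapsTo (fun x ↦ x + t • g x) (closedBall 0 1) (closedBall 0 1) := by
      intro x hx
      have h2 := (convex_closedBall (0 : E) 1) hx (by simp [hr1] : r x ∈ closedBall (0 : E) 1)
        (sub_nonneg.2 (htδ.trans hδ1)) ht.le (by ring)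
      convert h2 using 1
      simp only [g, smul_sub, sub_smul, one_smul]; abel
    have hbij := bijOn_closedBall_add_smul hK hg0 ht.le
      ((mul_le_mul_of_nonneg_right htδ (by positivity)).trans_lt hδK) hmaps
    have hcv := lintegral_abs_det_fderiv_eq_addHaar_image volume
      (measurableSet_closedBall (x := (0 : E)) (ε := 1))
      (f := fun x ↦ x + t • g x) (f' := fun x ↦ 1 + t • fderiv ℝ g x)
      (fun x _ ↦ ((hasFDerivAt_id x).add
        ((hg.differentiable one_ne_zero x).hasFDerivAt.const_smul t)).hasFDerivWithinAt) hbij.injOn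
    have hp : ∀ x ∈ closedBall (0 : E) 1, 0 < (1 + t • fderiv ℝ g x).det := by
      intro x hx
      apply hpos
      rw [norm_smul, Real.norm_of_nonneg ht.le]
      calc t * ‖fderiv ℝ g x‖ ≤ δ * |M| := by
            gcongr
            exact (hM x hx).trans (le_abs_self M)
        _ < ε := hδM
    rw [hbij.image_eq] at hcv
    rw [← hcv, integral_eq_lintegral_of_nonneg_ae]
    · congr 1
      refine setLIntegral_congr_fun measurableSet_closedBall fun x hx ↦ ?_
      simp only [abs_of_pos (hp x hx)]
    · filter_upwards [ae_restrict_mem measurableSet_closedBall] with x hx using (hp x hx).le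
    · exact (hdet.comp (continuous_const.add (hgd.const_smul t))).aestronglyMeasurable
  have hsing (x : E) : (1 + fderiv ℝ g x).det = 0 := by
    have hrd := (hr.differentiable one_ne_zero x).hasFDerivAt
    have hgr : 1 + fderiv ℝ g x = fderiv ℝ r x := by
      rw [show fderiv ℝ g x = _ from (hrd.sub (hasFDerivAt_id x)).fderiv]
      exact add_sub_cancel _ _
    rw [hgr]
    by_contra hne
    let e := (fderiv ℝ r x).toContinuousLinearEquivOfDetNeZero hne
    have hconst : HasFDerivAt (fun y ↦ ‖r y‖ ^ 2) (0 : E →L[ℝ] ℝ) x := by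
      simpa [hr1] using hasFDerivAt_const (1 : ℝ) x
    have h := congrArg (fun L : E →L[ℝ] ℝ ↦ L (e.symm (r x))) (hrd.norm_sq.unique hconst)
    have he : fderiv ℝ r x (e.symm (r x)) = r x := e.apply_symm_apply (r x)
    simp [he, hr1] at h
  let v : ℕ → ℝ := fun i ↦ δ / (i + 1)
  let s := Finset.range (finrank ℝ E + 1)
  have hv : Set.InjOn v s := by
    intro i _ j _ hij
    have hi : (0 : ℝ) < i + 1 := by positivity
    have hj : (0 : ℝ) < j + 1 := by positivity
    simp only [v] at hij
    rw [div_eq_div_iff hi.ne' hj.ne'] at hij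
    have := mul_left_cancel₀ hδ.ne' hij
    exact_mod_cast (add_right_cancel this).symm
  have hv0 (i : ℕ) : 0 < v i := by positivity
  have hvδ (i : ℕ) : v i ≤ δ := div_le_self hδ.le (by simp)
  have hint (i : ℕ) : IntegrableOn (fun x ↦ (1 + v i • fderiv ℝ g x).det) (closedBall (0 : E) 1) :=
    (hdet.comp (continuous_const.add (hgd.const_smul (v i)))).continuousOn.integrableOn_compact hcpt
  have hsum : ∑ i ∈ s, (Lagrange.basis s v i).eval 1 = 1 := by
    rw [← Polynomial.eval_finsetSum, Lagrange.sum_basis hv (by simp [s]), Polynomial.eval_one]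
  have key : ∫ x in closedBall (0 : E) 1, (1 + fderiv ℝ g x).det =
      (volume (closedBall (0 : E) 1)).toReal := by
    simp_rw [fun x ↦ det_one_add_eq_sum_lagrange (fderiv ℝ g x) hv (by simp [s])]
    rw [integral_finsetSum _ fun i _ ↦ (hint i).mul_const _]
    simp_rw [integral_mul_const, hvol _ (hv0 _) (hvδ _)]
    rw [← Finset.mul_sum, hsum, mul_one]
  simp only [hsing, integral_zero] at key
  exact (ENNReal.toReal_pos (measure_closedBall_pos volume (0 : E) one_pos).ne'
    hcpt.measure_lt_top.ne).ne key

/-- **Brouwer fixed point theorem** for the closed unit ball. -/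
theorem exists_fixedPoint_closedBall {f : E → E} (hf : ContinuousOn f (closedBall 0 1))
    (hmaps : MapsTo f (closedBall 0 1) (closedBall 0 1)) : ∃ x ∈ closedBall (0 : E) 1, f x = x := by
  by_contra! hne
  let ρ : E → E := fun x ↦ (max 1 ‖x‖)⁻¹ • x
  have hm (x : E) : (0 : ℝ) < max 1 ‖x‖ := by positivity
  have hρc : Continuous ρ :=
    ((continuous_const.max continuous_norm).inv₀ fun x ↦ (hm x).ne').smul continuous_id
  have hρ (x : E) : ρ x ∈ closedBall (0 : E) 1 := by
    rw [mem_closedBall_zero_iff, norm_smul, norm_inv, Real.norm_of_nonneg (hm x).le,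
      inv_mul_le_iff₀ (hm x), mul_one]
    exact le_max_right _ _
  have hρid (x : E) (hx : ‖x‖ ≤ 1) : ρ x = x := by simp [ρ, max_eq_left hx]
  -- a fixed point free extension of `f / 2` which is supported in the unit ball
  let a : E → ℝ := fun x ↦ max 0 (min (1 / 2) (1 - ‖x‖))
  let F : E → E := fun x ↦ a x • f (ρ ((2 : ℝ) • x))
  have hac : Continuous a := by fun_prop
  have hFc : Continuous F :=
    hac.smul (hf.comp_continuous (hρc.comp (continuous_const_smul _)) fun x ↦ hρ _)
  have hFne (x : E) : 0 < ‖x - F x‖ := by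
    rw [norm_pos_iff, sub_ne_zero]
    intro hx
    rcases le_or_gt ‖x‖ (1 / 2) with h | h
    · have ha : a x = 1 / 2 := by
        simp only [a]
        rw [min_eq_left (by linarith), max_eq_right (by norm_num)]
      have h2 : ‖(2 : ℝ) • x‖ ≤ 1 := by rw [norm_smul, Real.norm_ofNat]; linarith
      simp only [F, ha, hρid _ h2] at hx
      refine hne ((2 : ℝ) • x) (by simpa using h2) ?_
      conv_rhs => rw [hx]
      rw [smul_smul]; norm_num
    · have h1 : ‖F x‖ ≤ a x := by
        have h0 : 0 ≤ a x := le_max_left _ _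
        rw [norm_smul, Real.norm_of_nonneg h0]
        exact mul_le_of_le_one_right h0 (by simpa using hmaps (hρ ((2 : ℝ) • x)))
      have h2 : a x < ‖x‖ := max_lt (by linarith) ((min_le_left _ _).trans_lt h)
      rw [← hx] at h1
      linarith
  obtain ⟨G, hG, hGF, hGs⟩ := hFc.exists_contDiff_approx 1
    (continuous_id.sub hFc).norm hFne
  have hGne (x : E) : x - G x ≠ 0 := by
    intro h
    have := hGF x
    rw [← sub_eq_zero.1 h, dist_eq_norm] at this
    exact this.false
  have hGid (x : E) (hx : ‖x‖ = 1) : G x = 0 := by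
    by_contra h
    exact hGs h (by simp [F, a, hx])
  have hφ : ContDiff ℝ 1 fun x ↦ x - G x := contDiff_id.sub hG
  refine not_exists_contDiff_retraction_sphere (r := fun x ↦ ‖x - G x‖⁻¹ • (x - G x))
    (((hφ.norm ℝ hGne).inv fun x ↦ (norm_pos_iff.2 (hGne x)).ne').smul hφ)
    (fun x ↦ ?_) fun x hx ↦ ?_
  · rw [norm_smul, norm_inv, norm_norm, inv_mul_cancel₀ (norm_pos_iff.2 (hGne x)).ne']
  · simp [hGid x hx, hx]

end Brouwer

/-- **Topological linking lemma (Lemma l.top)** of Crovisier–Potrie–Sambarino. In `ℝ^k`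
(`k ≥ 2`, Euclidean norm), let `B` be the open unit ball, `D` the closed disc of radius `1/2`
in the hyperplane `{x_k = 0}`, and `β` the vertical segment `{0}^{k−1} × [−1/2, 1/2]`. Any
two continuous maps `b : β → B` and `h : D → B` that are `1/8`-close to the inclusions (in the
`C⁰`-distance) have intersecting images. -/
theorem stmt_7 (k : ℕ) (hk : 2 ≤ k)
    (b h : EuclideanSpace ℝ (Fin k) → EuclideanSpace ℝ (Fin k)) :
    let last : Fin k := ⟨k - 1, by omega⟩
    let β : Set (EuclideanSpace ℝ (Fin k)) :=
      {x | (∀ i : Fin k, i ≠ last → x i = 0) ∧ x last ∈ Icc (-(1/2) : ℝ) (1/2)}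
    let D : Set (EuclideanSpace ℝ (Fin k)) := {x | x last = 0 ∧ ‖x‖ ≤ 1/2}
    let B : Set (EuclideanSpace ℝ (Fin k)) := Metric.ball 0 1
    ContinuousOn b β → MapsTo b β B →
    ContinuousOn h D → MapsTo h D B →
    (∀ p ∈ β, dist (b p) p ≤ 1/8) →
    (∀ q ∈ D, dist (h q) q ≤ 1/8) →
    (b '' β ∩ h '' D).Nonempty := by
  intro last β D B hb _ hh _ hbd hhd
  let v (y : EuclideanSpace ℝ (Fin k)) : EuclideanSpace ℝ (Fin k) :=
    EuclideanSpace.single last (y last / 2)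
  let p (y : EuclideanSpace ℝ (Fin k)) := -v y
  let q (y : EuclideanSpace ℝ (Fin k)) := (1 / 2 : ℝ) • y - v y
  have hvc : Continuous v := by
    have : v = fun y ↦ (y last / 2) • EuclideanSpace.single last (1 : ℝ) := by
      ext y i; simp [v]
    rw [this]; fun_prop
  have hpβ : MapsTo p (closedBall 0 1) β := by
    intro y hy
    have hy1 : |y last| ≤ 1 := (PiLp.norm_apply_le y last).trans (by simpa using hy)
    rw [abs_le] at hy1
    refine ⟨fun i hi ↦ by simp [p, v, hi], ?_⟩
    simp only [p, v, PiLp.neg_apply, PiLp.single_apply, if_true, mem_Icc]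
    constructor <;> linarith
  have hqD : MapsTo q (closedBall 0 1) D := by
    intro y hy
    have hy1 : ‖y‖ ≤ 1 := by simpa using hy
    refine ⟨by simp [q, v]; ring, ?_⟩
    have : ‖q y‖ ≤ ‖(1 / 2 : ℝ) • y‖ := by
      rw [EuclideanSpace.norm_eq, EuclideanSpace.norm_eq]
      refine Real.sqrt_le_sqrt (Finset.sum_le_sum fun i _ ↦ ?_)
      by_cases hi : i = last
      · subst hi
        have : (q y) last = 0 := by simp [q, v]; ring
        rw [this]; simp
      · simp [q, v, hi]
    rw [norm_smul] at this
    norm_num at this ⊢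
    linarith
  obtain ⟨y, hy, hfix⟩ := exists_fixedPoint_closedBall
    (f := fun y ↦ y - (2 : ℝ) • (h (q y) - b (p y)))
    (continuousOn_id.sub (ContinuousOn.fun_const_smul
      ((hh.comp (by fun_prop) hqD).sub (hb.comp (by fun_prop) hpβ)) _))
    (fun y hy ↦ by
      have h1 := hhd _ (hqD hy)
      have h2 := hbd _ (hpβ hy)
      rw [dist_eq_norm] at h1 h2
      have : y - (2 : ℝ) • (h (q y) - b (p y)) =
          (2 : ℝ) • ((b (p y) - p y) - (h (q y) - q y)) := by
        simp only [p, q]; module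
      rw [mem_closedBall_zero_iff]
      beta_reduce
      rw [this, norm_smul, Real.norm_ofNat]
      have := norm_sub_le (b (p y) - p y) (h (q y) - q y)
      linarith)
  have heq : h (q y) = b (p y) := by simpa [sub_eq_zero] using hfix
  exact ⟨b (p y), mem_image_of_mem b (hpβ hy), q y, hqD hy, heq⟩
end

section
/- Let X be a compact metric space, f : X → X a homeomorphism, A ⊆ X a compact set, and Λ_f := ⋂_{n ∈ ℤ} fⁿ(A) the maximal invariant set of f in A. Then for every open set V with Λ_f ⊆ V there exists ε > 0 such that every homeomorphism g : X → X satisfying sup_{x ∈ X} d(f(x), g(x)) < ε and sup_{x ∈ X} d(f⁻¹(x), g⁻¹(x)) < ε has its maximal invariant set in A contained in V: ⋂_{n ∈ ℤ} gⁿ(A) ⊆ V. -/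
open Set

open Filter Topology

/-- The maximal invariant set consists of the points whose full orbit stays in `A`. -/
theorem mem_iInter_zpow_image_iff {α : Type*} (e : Equiv.Perm α) (A : Set α) (x : α) :
    x ∈ (⋂ n : ℤ, (e ^ n) '' A) ↔ ∀ n : ℤ, (e ^ n) x ∈ A := by
  simp only [mem_iInter, Equiv.image_eq_preimage_symm, mem_preimage]
  have symm_zpow (n : ℤ) : (e ^ n).symm = e ^ (-n) := (zpow_neg e n).symm
  simp only [symm_zpow]
  exact ⟨fun h n => by simpa using h (-n), fun h n => h (-n)⟩

/-- Integer iterates depend continuously on the homeomorphism (in the `C⁰`-topology) and on the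
point. -/
theorem tendsto_zpow_apply_of_tendstoUniformly {ι X : Type*} [UniformSpace X] {l : Filter ι}
    {f : X ≃ₜ X} {g : ι → X ≃ₜ X}
    (hg : TendstoUniformly (fun i => ⇑(g i)) f l)
    (hg' : TendstoUniformly (fun i => ⇑(g i).symm) f.symm l)
    {u : ι → X} {x : X} (hu : Tendsto u l (𝓝 x)) (n : ℤ) :
    Tendsto (fun i => ((g i).toEquiv ^ n : Equiv.Perm X) (u i)) l
      (𝓝 ((f.toEquiv ^ n : Equiv.Perm X) x)) := by
  have apply_add_one (h : X ≃ₜ X) (m : ℤ) (y : X) :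
      (h.toEquiv ^ (m + 1) : Equiv.Perm X) y = h ((h.toEquiv ^ m : Equiv.Perm X) y) := by
    rw [add_comm, zpow_one_add]; rfl
  have apply_sub_one (h : X ≃ₜ X) (m : ℤ) (y : X) :
      (h.toEquiv ^ (m - 1) : Equiv.Perm X) y = h.symm ((h.toEquiv ^ m : Equiv.Perm X) y) := by
    rw [sub_eq_neg_add, zpow_add, zpow_neg_one]; rfl
  induction n with
  | zero => simpa using hu
  | succ k ih =>
    simp only [apply_add_one]
    exact hg.tendsto_comp f.continuous.continuousAt ih
  | pred k ih =>
    simp only [apply_sub_one]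
    exact hg'.tendsto_comp f.symm.continuous.continuousAt ih

/-- Upper semicontinuity of maximal invariant sets in the `C⁰`-topology, used in the proof of
Proposition 5.4 of Crovisier–Potrie–Sambarino: if `f` is a homeomorphism of a compact metric
space `X`, `A ⊆ X` is compact and `V` is an open set containing the maximal invariant set
`Λ_f = ⋂_{n ∈ ℤ} fⁿ(A)`, then there is `ε > 0` such that every homeomorphism `g` with
`d(f x, g x) < ε` and `d(f⁻¹ x, g⁻¹ x) < ε` for all `x` has its maximal invariant set in `A`
contained in `V`. (The iterates `fⁿ`, `n ∈ ℤ`, are the powers of the underlying bijection.) -/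
theorem stmt_10 {X : Type*} [MetricSpace X] [CompactSpace X]
    (f : X ≃ₜ X) (A : Set X) (hA : IsCompact A) (V : Set X) (hV : IsOpen V)
    (hΛV : (⋂ n : ℤ, (f.toEquiv ^ n) '' A) ⊆ V) :
    ∃ ε > (0:ℝ), ∀ g : X ≃ₜ X,
      (∀ x, dist (f x) (g x) < ε) →
      (∀ x, dist (f.symm x) (g.symm x) < ε) →
      (⋂ n : ℤ, (g.toEquiv ^ n) '' A) ⊆ V := by
  by_contra! H
  choose g hg hg' hnot using fun k : ℕ => H (1 / ((k : ℝ) + 1)) Nat.one_div_pos_of_nat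
  choose u hu huV using fun k => not_subset.mp (hnot k)
  have eventually_lt (δ : ℝ) (hδ : 0 < δ) : ∀ᶠ k : ℕ in atTop, 1 / ((k : ℝ) + 1) < δ :=
    tendsto_one_div_add_atTop_nhds_zero_nat.eventually_lt_const hδ
  have unif : TendstoUniformly (fun k => ⇑(g k)) f atTop :=
    Metric.tendstoUniformly_iff.mpr fun δ hδ =>
      (eventually_lt δ hδ).mono fun k hk x => (hg k x).trans hk
  have unif_symm : TendstoUniformly (fun k => ⇑(g k).symm) f.symm atTop :=
    Metric.tendstoUniformly_iff.mpr fun δ hδ =>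
      (eventually_lt δ hδ).mono fun k hk x => (hg' k x).trans hk
  obtain ⟨x, φ, hφ, hx⟩ := CompactSpace.tendsto_subseq u
  have x_notMem : x ∉ V :=
    hV.isClosed_compl.mem_of_tendsto hx (Eventually.of_forall fun k => huV (φ k))
  refine x_notMem (hΛV ((mem_iInter_zpow_image_iff _ _ _).mpr fun n => ?_))
  have orbit_tendsto := tendsto_zpow_apply_of_tendstoUniformly (g := g ∘ φ)
    (fun s hs => hφ.tendsto_atTop.eventually (unif s hs))
    (fun s hs => hφ.tendsto_atTop.eventually (unif_symm s hs)) hx n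
  exact hA.isClosed.mem_of_tendsto orbit_tendsto
    (Eventually.of_forall fun k => (mem_iInter_zpow_image_iff _ _ _).mp (hu (φ k)) n)
end
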